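/- Let s > 0 and σ > 0 be real constants. Let X₀ be a real-valued random variable and let ε be a random variable with standard Gaussian law independent of X₀. Define Xₜ = s·X₀ + s·σ·ε and let pₜ(x) = ∫ φ(x; s·x₀, s²σ²) d(law of X₀)(x₀) be the density of Xₜ, where φ(·; m, v) denotes the Lebesgue density of the Gaussian with mean m and variance v. Then almost surely, E[ε | Xₜ] = −s·σ·(log pₜ)′(Xₜ); that is, the optimal (conditional-mean) noise predictor equals the negative marginal score scaled by s·σ. -/

import Mathlib

open MeasureTheory ProbabilityTheory
open scoped NNReal ENNReal

/-- Bayes' formula: if `(X, Y)` has density `k` with respect to `μ ⊗ ν`, then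
`E[h(X, Y) | Y = y] = (∫ h(x, y) k(x, y) dμ) / (∫ k(x, y) dμ)`. -/
theorem condExp_ae_eq_integral_div_integral_of_map_eq_withDensity
    {Ω α β : Type*} [MeasurableSpace Ω] [MeasurableSpace α] [mβ : MeasurableSpace β]
    {P : Measure Ω} [IsFiniteMeasure P] {μ : Measure α} [SFinite μ] {ν : Measure β} [SFinite ν]
    {X : Ω → α} {Y : Ω → β} (hX : Measurable X) (hY : Measurable Y)
    {k : α × β → ℝ} (hk : Measurable k) (hk_nonneg : ∀ z, 0 ≤ k z)
    (hk_pos : ∀ y, 0 < ∫ x, k (x, y) ∂μ)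
    (hlaw : P.map (fun ω => (X ω, Y ω)) = (μ.prod ν).withDensity fun z => ENNReal.ofReal (k z))
    {h : α × β → ℝ} (hh : Measurable h) (hint : Integrable (fun ω => h (X ω, Y ω)) P) :
    P[fun ω => h (X ω, Y ω) | mβ.comap Y]
      =ᵐ[P] fun ω => (∫ x, k (x, Y ω) * h (x, Y ω) ∂μ) / ∫ x, k (x, Y ω) ∂μ := by
  have hXY : Measurable fun ω => (X ω, Y ω) := hX.prodMk hY
  have hk' : Measurable fun z => ENNReal.ofReal (k z) := hk.ennreal_ofReal
  have hk_top : ∀ᵐ z ∂μ.prod ν, ENNReal.ofReal (k z) < ∞ := by simp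
  have integrable_iff : ∀ f : α × β → ℝ, Measurable f →
      (Integrable (fun ω => f (X ω, Y ω)) P ↔ Integrable (fun z => k z * f z) (μ.prod ν)) := by
    intro f hf
    rw [← Function.comp_def f, ← integrable_map_measure hf.aestronglyMeasurable hXY.aemeasurable,
      hlaw, integrable_withDensity_iff_integrable_smul' hk' hk_top]
    simp only [ENNReal.toReal_ofReal (hk_nonneg _), smul_eq_mul]
  have setIntegral_eq : ∀ f : α × β → ℝ, Measurable f →
      Integrable (fun z => k z * f z) (μ.prod ν) → ∀ B, MeasurableSet B →
      ∫ ω in Y ⁻¹' B, f (X ω, Y ω) ∂P = ∫ y in B, ∫ x, k (x, y) * f (x, y) ∂μ ∂ν := by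
    intro f hf hfint B hB
    have hB' : MeasurableSet (Set.univ ×ˢ B : Set (α × β)) := MeasurableSet.univ.prod hB
    have hpre : Y ⁻¹' B = (fun ω => (X ω, Y ω)) ⁻¹' (Set.univ ×ˢ B) := by ext; simp
    rw [hpre, ← setIntegral_map hB' hf.aestronglyMeasurable hXY.aemeasurable, hlaw,
      setIntegral_withDensity_eq_setIntegral_toReal_smul hk' (ae_restrict_of_ae hk_top) _ hB']
    simp only [ENNReal.toReal_ofReal (hk_nonneg _), smul_eq_mul]
    have hr : (μ.prod ν).restrict (Set.univ ×ˢ B) = μ.prod (ν.restrict B) := by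
      rw [← Measure.prod_restrict, Measure.restrict_univ]
    have hi := hfint.integrableOn (s := Set.univ ×ˢ B)
    rw [IntegrableOn, hr] at hi
    rw [hr, integral_prod_symm _ hi]
  have hhint := (integrable_iff h hh).1 hint
  set N : β → ℝ := fun y => ∫ x, k (x, y) * h (x, y) ∂μ
  set D : β → ℝ := fun y => ∫ x, k (x, y) ∂μ
  have hNm : Measurable N :=
    ((hk.mul hh).stronglyMeasurable.integral_prod_left').measurable
  have hDm : Measurable D := hk.stronglyMeasurable.integral_prod_left'.measurable
  have hNDm : Measurable fun y => N y / D y := hNm.div hDm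
  have hNint : Integrable N ν := hhint.integral_prod_right
  have hkint : ∀ y, Integrable (fun x => k (x, y)) μ := fun y =>
    not_not.1 fun hc => (hk_pos y).ne' (integral_undef hc)
  have hgint : Integrable (fun z : α × β => k z * (N z.2 / D z.2)) (μ.prod ν) := by
    have hm : Measurable fun z : α × β => k z * (N z.2 / D z.2) :=
      hk.mul (hNDm.comp measurable_snd)
    rw [integrable_prod_iff' hm.aestronglyMeasurable]
    refine ⟨.of_forall fun y => (hkint y).mul_const (N y / D y),
      hNint.norm.congr (.of_forall fun y => ?_)⟩
    simp only [norm_mul, Real.norm_of_nonneg (hk_nonneg _), integral_mul_const, norm_div]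
    change ‖N y‖ = D y * (‖N y‖ / ‖D y‖)
    rw [Real.norm_of_nonneg (hk_pos y).le, mul_div_cancel₀ _ (hk_pos y).ne']
  symm
  refine ae_eq_condExp_of_forall_setIntegral_eq hY.comap_le hint ?_ ?_ ?_
  · exact fun _ _ _ => ((integrable_iff (fun z => N z.2 / D z.2)
      (hNDm.comp measurable_snd)).2 hgint).integrableOn
  · rintro _ ⟨B, hB, rfl⟩ -
    rw [setIntegral_eq h hh hhint B hB]
    refine (setIntegral_eq (fun z => N z.2 / D z.2)
      (hNDm.comp measurable_snd) hgint B hB).trans ?_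
    refine integral_congr_ae (.of_forall fun y => ?_)
    simp only [integral_mul_const]
    exact mul_div_cancel₀ _ (hk_pos y).ne'
  · exact (hNDm.comp (comap_measurable Y)).stronglyMeasurable.aestronglyMeasurable

theorem hasDerivAt_gaussianPDFReal (m : ℝ) (v : ℝ≥0) (x : ℝ) :
    HasDerivAt (gaussianPDFReal m v) (-((x - m) / v) * gaussianPDFReal m v x) x := by
  rw [gaussianPDFReal_def]
  have h := ((((((hasDerivAt_id x).sub_const m).pow 2).neg).div_const (2 * (v : ℝ))).exp).const_mul
    ((√(2 * Real.pi * v))⁻¹)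
  convert! h using 1
  simp only [id, Pi.neg_apply, Pi.pow_apply]
  by_cases hv : (v : ℝ) = 0
  · simp [hv]
  · field_simp
    simp [mul_comm]

theorem gaussianPDFReal_le_inv_sqrt (m : ℝ) (v : ℝ≥0) (x : ℝ) :
    gaussianPDFReal m v x ≤ (√(2 * Real.pi * v))⁻¹ := by
  rw [gaussianPDFReal]
  refine mul_le_of_le_one_right (by positivity) (Real.exp_le_one_iff.2 ?_)
  exact div_nonpos_of_nonpos_of_nonneg (by nlinarith [sq_nonneg (x - m)]) (by positivity)

theorem abs_sub_mul_gaussianPDFReal_le (m : ℝ) (v : ℝ≥0) (x : ℝ) :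
    |x - m| * gaussianPDFReal m v x ≤ (√(2 * Real.pi * v))⁻¹ * (1 / 2 + v) := by
  rcases eq_or_ne v 0 with rfl | hv
  · simp
  have hv' : (0 : ℝ) < v := by positivity
  rw [gaussianPDFReal, mul_left_comm]
  refine mul_le_mul_of_nonneg_left ?_ (by positivity)
  rw [neg_div, Real.exp_neg, ← div_eq_mul_inv, div_le_iff₀ (Real.exp_pos _)]
  have h1 : |x - m| ≤ (1 + (x - m) ^ 2) / 2 := by
    nlinarith [sq_nonneg (|x - m| - 1), sq_abs (x - m)]
  have h2 := Real.add_one_le_exp ((x - m) ^ 2 / (2 * v))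
  have h3 : (1 / 2 + (v : ℝ)) * ((x - m) ^ 2 / (2 * v) + 1)
      = (1 + (x - m) ^ 2) / 2 + (v + (x - m) ^ 2 / (4 * v)) := by
    field_simp
    ring
  have h4 : 0 ≤ (v : ℝ) + (x - m) ^ 2 / (4 * v) := by positivity
  calc |x - m| ≤ (1 / 2 + (v : ℝ)) * ((x - m) ^ 2 / (2 * v) + 1) := by linarith
    _ ≤ _ := by gcongr

theorem measurable_gaussianPDFReal_mean {α : Type*} [MeasurableSpace α] {f g : α → ℝ}
    (hf : Measurable f) (hg : Measurable g) (v : ℝ≥0) :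
    Measurable fun a => gaussianPDFReal (f a) v (g a) := by
  unfold gaussianPDFReal
  fun_prop

theorem integrable_gaussianPDFReal_mean {α : Type*} [MeasurableSpace α] (μ : Measure α)
    [IsFiniteMeasure μ] {f : α → ℝ} (hf : Measurable f) (v : ℝ≥0) (x : ℝ) :
    Integrable (fun a => gaussianPDFReal (f a) v x) μ := by
  refine .of_bound (measurable_gaussianPDFReal_mean hf measurable_const v).aestronglyMeasurable
    ((√(2 * Real.pi * v))⁻¹) (.of_forall fun a => ?_)
  rw [Real.norm_of_nonneg (gaussianPDFReal_nonneg _ _ _)]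
  exact gaussianPDFReal_le_inv_sqrt _ _ _

/-- Differentiation under the integral sign for the density of a Gaussian mixture. -/
theorem hasDerivAt_integral_gaussianPDFReal {α : Type*} [MeasurableSpace α] (μ : Measure α)
    [IsFiniteMeasure μ] {f : α → ℝ} (hf : Measurable f) (v : ℝ≥0) (x : ℝ) :
    HasDerivAt (fun x => ∫ a, gaussianPDFReal (f a) v x ∂μ)
      (∫ a, -((x - f a) / v) * gaussianPDFReal (f a) v x ∂μ) x := by
  refine (hasDerivAt_integral_of_dominated_loc_of_deriv_le
    (F' := fun x a => -((x - f a) / v) * gaussianPDFReal (f a) v x)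
    (bound := fun _ => (√(2 * Real.pi * v))⁻¹ * (1 / 2 + v) / v) Filter.univ_mem
    (.of_forall fun y => (integrable_gaussianPDFReal_mean μ hf v y).aestronglyMeasurable)
    (integrable_gaussianPDFReal_mean μ hf v x) ?_ (.of_forall fun a y _ => ?_)
    (integrable_const _) (.of_forall fun a y _ => hasDerivAt_gaussianPDFReal _ _ _)).2
  · exact (((measurable_const.sub hf).div_const _).neg.mul
      (measurable_gaussianPDFReal_mean hf measurable_const v)).aestronglyMeasurable
  · rw [norm_mul, norm_neg, norm_div, Real.norm_of_nonneg (gaussianPDFReal_nonneg _ _ _),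
      Real.norm_of_nonneg v.coe_nonneg, Real.norm_eq_abs, div_mul_eq_mul_div]
    exact div_le_div_of_nonneg_right (abs_sub_mul_gaussianPDFReal_le _ _ _) v.coe_nonneg

theorem integral_gaussianPDFReal_pos {α : Type*} [MeasurableSpace α] (μ : Measure α)
    [IsProbabilityMeasure μ] {f : α → ℝ} (hf : Measurable f) {v : ℝ≥0} (hv : v ≠ 0) (x : ℝ) :
    0 < ∫ a, gaussianPDFReal (f a) v x ∂μ := by
  rw [integral_pos_iff_support_of_nonneg (fun _ => gaussianPDFReal_nonneg _ _ _)
    (integrable_gaussianPDFReal_mean μ hf v x)]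
  have : (Function.support fun a => gaussianPDFReal (f a) v x) = Set.univ := by
    ext a
    simp [(gaussianPDFReal_pos (f a) v x hv).ne']
  simp [this]

/-- The joint law of a random variable and an affine Gaussian perturbation of it. -/
theorem map_prodMk_const_mul_add_gaussian
    {Ω : Type*} [MeasurableSpace Ω] {P : Measure Ω} [IsProbabilityMeasure P]
    {X ε : Ω → ℝ} (hX : Measurable X) (hε : Measurable ε)
    (hεlaw : P.map ε = gaussianReal 0 1) (hindep : IndepFun X ε P) (a : ℝ) {b : ℝ} (hb : b ≠ 0) :
    P.map (fun ω => (X ω, a * X ω + b * ε ω))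
      = ((P.map X).prod volume).withDensity
        fun z => ENNReal.ofReal (gaussianPDFReal (a * z.1) ((b ^ 2).toNNReal) z.2) := by
  have hv : (b ^ 2).toNNReal ≠ 0 := by simpa using hb
  have : IsProbabilityMeasure (P.map X) := Measure.isProbabilityMeasure_map hX.aemeasurable
  have hT : Measurable fun z : ℝ × ℝ => (z.1, a * z.1 + b * z.2) := by fun_prop
  have hk : Measurable fun z : ℝ × ℝ =>
      ENNReal.ofReal (gaussianPDFReal (a * z.1) ((b ^ 2).toNNReal) z.2) :=
    (measurable_gaussianPDFReal_mean (measurable_fst.const_mul a) measurable_snd _).ennreal_ofReal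
  have hcomp : (fun ω => (X ω, a * X ω + b * ε ω))
      = (fun z : ℝ × ℝ => (z.1, a * z.1 + b * z.2)) ∘ fun ω => (X ω, ε ω) := rfl
  have hmap : ∀ c : ℝ, (gaussianReal 0 1).map (fun e => c + b * e)
      = gaussianReal c ((b ^ 2).toNNReal) := by
    intro c
    have : (fun e => c + b * e) = (fun e => c + e) ∘ (fun e => b * e) := rfl
    rw [this, ← Measure.map_map (by fun_prop) (by fun_prop), gaussianReal_map_const_mul,
      gaussianReal_map_const_add]
    congr 1
    · simp
    · ext
      simp [sq_nonneg]
  rw [hcomp, ← Measure.map_map hT (hX.prodMk hε),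
    (indepFun_iff_map_prod_eq_prod_map_map hX.aemeasurable hε.aemeasurable).1 hindep, hεlaw]
  refine Measure.ext_of_lintegral _ fun F hF => ?_
  have hFT : Measurable fun z : ℝ × ℝ => F (z.1, a * z.1 + b * z.2) := hF.comp hT
  rw [lintegral_map hF hT, lintegral_prod _ hFT.aemeasurable,
    lintegral_withDensity_eq_lintegral_mul _ hk hF, lintegral_prod _ (hk.mul hF).aemeasurable]
  refine lintegral_congr fun x => ?_
  have hFx : Measurable fun y => F (x, y) := hF.comp measurable_prodMk_left
  calc ∫⁻ e, F (x, a * x + b * e) ∂gaussianReal 0 1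
      = ∫⁻ y, F (x, y) ∂(gaussianReal 0 1).map (fun e => a * x + b * e) :=
        (lintegral_map hFx (by fun_prop)).symm
    _ = _ := by
        rw [hmap, gaussianReal_of_var_ne_zero _ hv,
          lintegral_withDensity_eq_lintegral_mul _ (measurable_gaussianPDF _ _) hFx]
        rfl


/-- The optimal (conditional-mean) noise predictor equals the negative marginal score scaled
by `s σ`: almost surely `E[ε | Xₜ] = - s σ (log pₜ)'(Xₜ)`. -/
theorem condexp_noise_eq_neg_scaled_score
    {Ω : Type*} [MeasurableSpace Ω] (P : Measure Ω) [IsProbabilityMeasure P]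
    (s σ : ℝ) (hs : 0 < s) (hσ : 0 < σ)
    (X₀ ε : Ω → ℝ) (hX₀ : Measurable X₀) (hε : Measurable ε)
    (hεlaw : Measure.map ε P = gaussianReal 0 1)
    (hindep : IndepFun X₀ ε P)
    (Xt : Ω → ℝ) (hXt : ∀ ω, Xt ω = s * X₀ ω + s * σ * ε ω)
    (pt : ℝ → ℝ)
    (hpt : ∀ x, pt x = ∫ x₀, gaussianPDFReal (s * x₀) ((s ^ 2 * σ ^ 2).toNNReal) x
      ∂(Measure.map X₀ P)) :
    P[ε | MeasurableSpace.comap Xt (by infer_instance)]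
      =ᵐ[P] fun ω => -(s * σ) * deriv (fun x => Real.log (pt x)) (Xt ω) := by

  have hb : s * σ ≠ 0 := (mul_pos hs hσ).ne'
  have hv : ((s * σ) ^ 2).toNNReal ≠ 0 := by simpa using hb
  obtain rfl : Xt = fun ω => s * X₀ ω + s * σ * ε ω := funext hXt
  have hXtm : Measurable fun ω => s * X₀ ω + s * σ * ε ω := by fun_prop
  have hprob : IsProbabilityMeasure (P.map X₀) := Measure.isProbabilityMeasure_map hX₀.aemeasurable
  have hmean : Measurable fun x₀ : ℝ => s * x₀ := by fun_prop
  rw [← mul_pow] at hpt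
  obtain rfl : pt = _ := funext hpt
  have hεint : Integrable ε P := by
    have h : Integrable id (P.map ε) := by
      rw [hεlaw]
      exact (memLp_id_gaussianReal 1).integrable (by simp)
    exact h.comp_measurable hε
  have hεeq : ε = fun ω => (fun z : ℝ × ℝ => (z.2 - s * z.1) / (s * σ))
      (X₀ ω, s * X₀ ω + s * σ * ε ω) := by
    ext ω
    field_simp
    ring
  have key := condExp_ae_eq_integral_div_integral_of_map_eq_withDensity hX₀ hXtm
    (measurable_gaussianPDFReal_mean (measurable_fst.const_mul s) measurable_snd _)
    (fun _ => gaussianPDFReal_nonneg _ _ _) (integral_gaussianPDFReal_pos _ hmean hv)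
    (map_prodMk_const_mul_add_gaussian hX₀ hε hεlaw hindep s hb)
    (h := fun z : ℝ × ℝ => (z.2 - s * z.1) / (s * σ)) (by fun_prop) (hεeq ▸ hεint)
  rw [← hεeq] at key
  refine key.trans (.of_forall fun ω => ?_)
  have hpos := integral_gaussianPDFReal_pos (P.map X₀) hmean hv (s * X₀ ω + s * σ * ε ω)
  have hder := hasDerivAt_integral_gaussianPDFReal (P.map X₀) hmean ((s * σ) ^ 2).toNNReal
    (s * X₀ ω + s * σ * ε ω)
  dsimp only
  rw [(hder.log hpos.ne').deriv, ← mul_div_assoc, ← integral_const_mul]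
  congr 2
  ext x₀
  rw [Real.coe_toNNReal _ (sq_nonneg _)]
  field_simp
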